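/- arXiv:2201.13088 — 2 statements merged into one kernel-verified Lean document; each statement's English description precedes it below -/
import Mathlib

section
/- Let U₁, …, U_s be pairwise strictly orthogonal pure finite-dimensional subspaces of V, and let I₁, …, I_s be compatible complex structures with I_i(U_i) = U_i for every i and I_i ≠ ±I_j whenever i ≠ j. Set U = U₁ + … + U_s. If W is a nonzero subspace of U and A is a compatible complex structure with A(W) = W, then there exists an index i such that (A = I_i or A = −I_i) and W ⊆ U_i. (The decomposition of a Σ-complex subspace into an orthogonal sum of maximal pure complex subspaces by different structures, up to sign, is unique.) -/
open RealInnerProductSpace Module Submodule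

lemma span_aux {V : Type*} [AddCommGroup V] [Module ℝ V]
    (I J K : V →ₗ[ℝ] V)
    (hII : ∀ x, I (I x) = -x) (hJJ : ∀ x, J (J x) = -x) (hKK : ∀ x, K (K x) = -x)
    (hIJ : ∀ x, I (J x) = K x) (hJI : ∀ x, J (I x) = -K x)
    (hIK : ∀ x, I (K x) = -J x) (hKI : ∀ x, K (I x) = J x)
    (hJK : ∀ x, J (K x) = I x) (hKJ : ∀ x, K (J x) = -I x)
    (A B : V →ₗ[ℝ] V)
    (hA : ∃ a b c : ℝ, a ^ 2 + b ^ 2 + c ^ 2 = 1 ∧ A = a • I + b • J + c • K)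
    (hB : ∃ a b c : ℝ, a ^ 2 + b ^ 2 + c ^ 2 = 1 ∧ B = a • I + b • J + c • K)
    (h1 : A ≠ B) (h2 : A ≠ -B) (T : Submodule ℝ V) (x : V) (hx : x ∈ T)
    (hAx : A x ∈ T) (hBx : B x ∈ T) (hABx : A (B x) ∈ T) :
    I x ∈ T ∧ J x ∈ T ∧ K x ∈ T := by
  obtain ⟨a, b, c, hn, rfl⟩ := hA
  obtain ⟨p, q, r, hm, rfl⟩ := hB
  obtain ⟨u, hu⟩ : ∃ u, u = b * r - c * q := ⟨_, rfl⟩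
  obtain ⟨v, hv⟩ : ∃ v, v = c * p - a * r := ⟨_, rfl⟩
  obtain ⟨w, hw⟩ : ∃ w, w = a * q - b * p := ⟨_, rfl⟩
  have hD : u ^ 2 + v ^ 2 + w ^ 2 ≠ 0 := by
    intro h
    obtain ⟨t, ht⟩ : ∃ t, t = a * p + b * q + c * r := ⟨_, rfl⟩
    have ht2 : (t - 1) * (t + 1) = 0 := by
      subst hu hv hw ht
      linear_combination (-1) * h + (p ^ 2 + q ^ 2 + r ^ 2) * hn + hm
    have key : (a - t * p) ^ 2 + (b - t * q) ^ 2 + (c - t * r) ^ 2 = 0 := by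
      have : t ^ 2 = 1 := by linarith
      linear_combination hn + t ^ 2 * hm - this + 2 * t * ht
    have e1 : a = t * p := by nlinarith [sq_nonneg (a - t * p), sq_nonneg (b - t * q), sq_nonneg (c - t * r)]
    have e2 : b = t * q := by nlinarith [sq_nonneg (a - t * p), sq_nonneg (b - t * q), sq_nonneg (c - t * r)]
    have e3 : c = t * r := by nlinarith [sq_nonneg (a - t * p), sq_nonneg (b - t * q), sq_nonneg (c - t * r)]
    rcases mul_eq_zero.1 ht2 with h | h
    · have : t = 1 := by linarith
      apply h1; rw [e1, e2, e3, this]; simp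
    · have : t = -1 := by linarith
      apply h2; rw [e1, e2, e3, this]; simp; abel
  have hR : u • I x + v • J x + w • K x ∈ T := by
    have := T.add_mem hABx (T.smul_mem (a * p + b * q + c * r) hx)
    convert this using 1
    simp only [LinearMap.add_apply, LinearMap.smul_apply, map_add, map_smul, hII, hJJ, hKK, hIJ,
      hJI, hIK, hKI, hJK, hKJ]
    subst hu hv hw
    module
  simp only [LinearMap.add_apply, LinearMap.smul_apply] at hAx hBx
  have fin : ∀ (α β γ : ℝ) (z : V), α • (a • I x + b • J x + c • K x)
      + β • (p • I x + q • J x + r • K x) + γ • (u • I x + v • J x + w • K x)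
      = (u ^ 2 + v ^ 2 + w ^ 2) • z → z ∈ T := by
    intro α β γ z h
    rw [← Submodule.smul_mem_iff T hD, ← h]
    exact T.add_mem (T.add_mem (T.smul_mem _ hAx) (T.smul_mem _ hBx)) (T.smul_mem _ hR)
  refine ⟨fin (q * w - r * v) (v * c - w * b) u _ ?_, fin (r * u - p * w) (w * a - u * c) v _ ?_,
    fin (p * v - q * u) (u * b - v * a) w _ ?_⟩ <;>
  · subst hu hv hw
    module

lemma map_eq_aux {V : Type*} [AddCommGroup V] [Module ℝ V] (I : V →ₗ[ℝ] V)
    (hII : ∀ x, I (I x) = -x) (S : Submodule ℝ V) (h : ∀ x ∈ S, I x ∈ S) : S.map I = S := by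
  apply le_antisymm
  · rintro _ ⟨x, hx, rfl⟩
    exact h x hx
  · intro x hx
    exact ⟨-(I x), S.neg_mem (h x hx), by simp [hII]⟩

set_option maxHeartbeats 1000000 in
/-- The decomposition of a Σ-complex subspace into an orthogonal sum of maximal
pure complex subspaces by different (up to sign) structures is unique: any
complex subspace of the sum lies inside one of the addends. -/
theorem stmt_18 {V : Type*} [NormedAddCommGroup V] [InnerProductSpace ℝ V]
    [FiniteDimensional ℝ V]
    (I J K : V →ₗ[ℝ] V)
    (hII : ∀ x, I (I x) = -x) (hJJ : ∀ x, J (J x) = -x) (hKK : ∀ x, K (K x) = -x)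
    (hIJ : ∀ x, I (J x) = K x) (hJI : ∀ x, J (I x) = -K x)
    (hIsk : ∀ x y, ⟪I x, y⟫ = -⟪x, I y⟫)
    (hJsk : ∀ x y, ⟪J x, y⟫ = -⟪x, J y⟫)
    (hKsk : ∀ x y, ⟪K x, y⟫ = -⟪x, K y⟫)
    (s : ℕ) (Us : Fin s → Submodule ℝ V) (Is : Fin s → (V →ₗ[ℝ] V))
    (hIs : ∀ i, ∃ a b c : ℝ, a ^ 2 + b ^ 2 + c ^ 2 = 1 ∧
      Is i = a • I + b • J + c • K)
    (hcomplex : ∀ i, (Us i).map (Is i) = Us i)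
    (hpure : ∀ i, ∀ S : Submodule ℝ V, S ≤ Us i →
      S.map I = S → S.map J = S → S.map K = S → S = ⊥)
    (horth : ∀ i j, i ≠ j → ∀ x ∈ Us i, ∀ y ∈ Us j, ⟪x, y⟫ = 0)
    (hne : ∀ i j, i ≠ j → Is i ≠ Is j ∧ Is i ≠ -(Is j))
    (W : Submodule ℝ V) (hW0 : W ≠ ⊥) (hWle : W ≤ ⨆ i, Us i)
    (A : V →ₗ[ℝ] V)
    (hA : ∃ a b c : ℝ, a ^ 2 + b ^ 2 + c ^ 2 = 1 ∧ A = a • I + b • J + c • K)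
    (hAW : W.map A = W) :
    ∃ i, (A = Is i ∨ A = -(Is i)) ∧ W ≤ Us i := by
  have hIK : ∀ x, I (K x) = -J x := fun x => by rw [← hIJ, hII]
  have hKJ : ∀ x, K (J x) = -I x := fun x => by rw [← hIJ, hJJ, map_neg]
  have hKI : ∀ x, K (I x) = J x := fun x => by rw [← hIJ, hJI, map_neg, hIK, neg_neg]
  have hJK : ∀ x, J (K x) = I x := fun x => by rw [← hIJ, hJI, hKJ, neg_neg]
  have hsp := span_aux I J K hII hJJ hKK hIJ hJI hIK hKI hJK hKJ
  have hmem : ∀ i, ∀ x ∈ Us i, Is i x ∈ Us i := fun i x hx => by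
    have := Submodule.mem_map_of_mem (f := Is i) hx
    rwa [hcomplex] at this
  have hAmem : ∀ x ∈ W, A x ∈ W := fun x hx => by
    have := Submodule.mem_map_of_mem (f := A) hx
    rwa [hAW] at this
  have hsk : ∀ B : V →ₗ[ℝ] V, (∃ a b c : ℝ, a ^ 2 + b ^ 2 + c ^ 2 = 1 ∧ B = a • I + b • J + c • K) →
      ∀ x y, ⟪B x, y⟫ = -⟪x, B y⟫ := by
    rintro B ⟨a, b, c, -, rfl⟩ x y
    simp only [LinearMap.add_apply, LinearMap.smul_apply, inner_add_left, inner_add_right,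
      real_inner_smul_left, real_inner_smul_right, hIsk, hJsk, hKsk]
    ring
  have hAA : ∀ x, A (A x) = -x := by
    obtain ⟨a, b, c, h, rfl⟩ := hA
    intro x
    simp only [LinearMap.add_apply, LinearMap.smul_apply, map_add, map_smul, hII, hJJ, hKK, hIJ,
      hJI, hIK, hKI, hJK, hKJ]
    have : -x = -((a ^ 2 + b ^ 2 + c ^ 2) • x) := by rw [h, one_smul]
    refine Eq.trans ?_ this.symm
    module
  -- quaternionic orthogonality
  have hort : ∀ i j, i ≠ j → ∀ x ∈ Us i, ∀ y ∈ Us j, ⟪x, A y⟫ = 0 := by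
    intro i j hij x hx y hy
    have h := hsp (Is i) (Is j) (hIs i) (hIs j) (hne i j hij).1 (hne i j hij).2 (Us i)ᗮ y
      (by
        rw [Submodule.mem_orthogonal]
        intro u hu
        exact horth i j hij u hu y hy)
      (by
        rw [Submodule.mem_orthogonal]
        intro u hu
        have h1 := hsk _ (hIs i) u y
        have h2 := horth i j hij _ (hmem i u hu) y hy
        linarith)
      (by
        rw [Submodule.mem_orthogonal]
        intro u hu
        exact horth i j hij u hu _ (hmem j y hy))
      (by
        rw [Submodule.mem_orthogonal]
        intro u hu
        have h1 := hsk _ (hIs i) u (Is j y)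
        have h2 := horth i j hij _ (hmem i u hu) _ (hmem j y hy)
        linarith)
    simp only [Submodule.mem_orthogonal] at h
    obtain ⟨a, b, c, -, rfl⟩ := hA
    simp only [LinearMap.add_apply, LinearMap.smul_apply, inner_add_right,
      real_inner_smul_right, h.1 x hx, h.2.1 x hx, h.2.2 x hx]
    ring
  -- purity
  have hpur : ∀ i, A ≠ Is i → A ≠ -(Is i) → ∀ x ∈ Us i, A x ∈ Us i → x = 0 := by
    intro i h1 h2 x hx hAx
    have h := hsp (Is i) A (hIs i) hA (Ne.symm h1) (fun e => h2 (by rw [e, neg_neg])) (Us i) x hx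
      (hmem i x hx) hAx (hmem i _ hAx)
    let S : Submodule ℝ V := Us i ⊓ ((Us i).comap I ⊓ ((Us i).comap J ⊓ (Us i).comap K))
    have hS : S = ⊥ := by
      apply hpure i S inf_le_left
      · apply map_eq_aux I hII
        rintro y ⟨y1, y2, y3, y4⟩
        refine ⟨y2, ?_, ?_, ?_⟩
        · change I (I y) ∈ Us i
          rw [hII]
          exact neg_mem y1
        · change J (I y) ∈ Us i
          rw [hJI]
          exact neg_mem y4
        · change K (I y) ∈ Us i
          rw [hKI]
          exact y3
      · apply map_eq_aux J hJJ
        rintro y ⟨y1, y2, y3, y4⟩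
        refine ⟨y3, ?_, ?_, ?_⟩
        · change I (J y) ∈ Us i
          rw [hIJ]
          exact y4
        · change J (J y) ∈ Us i
          rw [hJJ]
          exact neg_mem y1
        · change K (J y) ∈ Us i
          rw [hKJ]
          exact neg_mem y2
      · apply map_eq_aux K hKK
        rintro y ⟨y1, y2, y3, y4⟩
        refine ⟨y4, ?_, ?_, ?_⟩
        · change I (K y) ∈ Us i
          rw [hIK]
          exact neg_mem y3
        · change J (K y) ∈ Us i
          rw [hJK]
          exact y2
        · change K (K y) ∈ Us i
          rw [hKK]
          exact neg_mem y1
    have : x ∈ S := ⟨hx, h.1, h.2.1, h.2.2⟩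
    rw [hS] at this
    simpa using this
  have hdec : ∀ x ∈ ⨆ i, Us i, ∃ f : Fin s → V, (∀ i, f i ∈ Us i) ∧ ∑ i, f i = x := by
    intro x hx
    rw [Submodule.mem_iSup_iff_exists_finsupp] at hx
    obtain ⟨f, hf, hfx⟩ := hx
    refine ⟨f, hf, ?_⟩
    rw [← hfx, Finsupp.sum_fintype _ _ (fun _ => rfl)]
  have hcomp : ∀ x ∈ W, ∃ f : Fin s → V, (∀ i, f i ∈ Us i) ∧ ∑ i, f i = x ∧
      ∀ i, A ≠ Is i → A ≠ -(Is i) → f i = 0 := by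
    intro x hx
    obtain ⟨f, hf, hfx⟩ := hdec x (hWle hx)
    obtain ⟨g, hg, hgx⟩ := hdec _ (hWle (hAmem x hx))
    refine ⟨f, hf, hfx, fun i h1 h2 => hpur i h1 h2 _ (hf i) ?_⟩
    have hsum : ∑ j, (A (f j) - g j) = 0 := by
      rw [Finset.sum_sub_distrib, hgx, ← map_sum, hfx, sub_self]
    have h0 : ⟪A (f i) - g i, A (f i) - g i⟫ = 0 := by
      have h3 : ⟪A (f i) - g i, ∑ j, (A (f j) - g j)⟫ = 0 := by rw [hsum, inner_zero_right]
      rw [inner_sum, Finset.sum_eq_single i] at h3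
      · exact h3
      · intro j _ hji
        have k1 := hort i j hji.symm _ (hg i) _ (hf j)
        have k2 := hort j i hji _ (hg j) _ (hf i)
        have k3 := horth i j hji.symm _ (hg i) _ (hg j)
        have k4 := horth i j hji.symm _ (hf i) _ (hf j)
        have k5 := hsk A hA (f i) (A (f j))
        rw [hAA, inner_neg_right, k4] at k5
        rw [real_inner_comm] at k2
        rw [inner_sub_left, inner_sub_right, inner_sub_right, k1, k2, k3, k5]
        simp
      · simp
    have := sub_eq_zero.1 (inner_self_eq_zero.1 h0)
    rw [this]
    exact hg i
  obtain ⟨x, hx, hx0⟩ := Submodule.exists_mem_ne_zero_of_ne_bot hW0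
  have hex : ∃ i, A = Is i ∨ A = -(Is i) := by
    by_contra hcon
    push Not at hcon
    obtain ⟨f, -, hfx, hf0⟩ := hcomp x hx
    apply hx0
    rw [← hfx]
    exact Finset.sum_eq_zero fun i _ => hf0 i (hcon i).1 (hcon i).2
  obtain ⟨i, hi⟩ := hex
  refine ⟨i, hi, fun y hy => ?_⟩
  obtain ⟨f, hf, hfx, hf0⟩ := hcomp y hy
  rw [← hfx, Finset.sum_eq_single i]
  · exact hf i
  · intro j _ hji
    have hn := hne j i hji
    apply hf0 j
    · intro e
      rcases hi with h | h
      · exact hn.1 (e.symm.trans h)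
      · exact hn.2 (e.symm.trans h)
    · intro e
      rcases hi with h | h
      · exact hn.2 (by rw [← h, e, neg_neg])
      · exact hn.1 (neg_injective (e.symm.trans h))
  · simp
end

section
/- Let U be a pure finite-dimensional subspace of V with I(U) = U. If U' is a nonzero subspace of U and Ĩ is a compatible complex structure with Ĩ(U') = U', then Ĩ = I or Ĩ = −I. (A pure I-complex subspace contains no complex subspace by a complex structure different from ±I.) -/
open RealInnerProductSpace Module Submodule

/-- A pure `I`-complex subspace contains no complex subspace by a compatible
complex structure different from `±I`. -/
theorem stmt_19 {V : Type*} [NormedAddCommGroup V] [InnerProductSpace ℝ V]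
    [FiniteDimensional ℝ V]
    (I J K : V →ₗ[ℝ] V)
    (hII : ∀ x, I (I x) = -x) (hJJ : ∀ x, J (J x) = -x) (hKK : ∀ x, K (K x) = -x)
    (hIJ : ∀ x, I (J x) = K x) (hJI : ∀ x, J (I x) = -K x)
    (hIsk : ∀ x y, ⟪I x, y⟫ = -⟪x, I y⟫)
    (hJsk : ∀ x y, ⟪J x, y⟫ = -⟪x, J y⟫)
    (hKsk : ∀ x y, ⟪K x, y⟫ = -⟪x, K y⟫)
    (U : Submodule ℝ V) (hUI : U.map I = U)
    (hpure : ∀ S : Submodule ℝ V, S ≤ U →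
      S.map I = S → S.map J = S → S.map K = S → S = ⊥)
    (U' : Submodule ℝ V) (hU'le : U' ≤ U) (hU'0 : U' ≠ ⊥)
    (It : V →ₗ[ℝ] V)
    (hIt : ∃ a b c : ℝ, a ^ 2 + b ^ 2 + c ^ 2 = 1 ∧ It = a • I + b • J + c • K)
    (hItU' : U'.map It = U') :
    It = I ∨ It = -I := by
  obtain ⟨a, b, c, habc, rfl⟩ := hIt
  by_cases hbc : b ^ 2 + c ^ 2 = 0
  · have hb : b = 0 := by nlinarith [sq_nonneg b, sq_nonneg c]
    have hc : c = 0 := by nlinarith [sq_nonneg b, sq_nonneg c]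
    subst hb hc
    have ha : a ^ 2 = 1 := by linarith
    rcases (show a = 1 ∨ a = -1 by simpa using ha) with h | h
    · left; subst h; simp
    · right; subst h; simp
  exfalso
  apply hU'0
  have hIK : ∀ x, I (K x) = -J x := fun x => by rw [← hIJ, hII]
  set S : Submodule ℝ V := U' ⊔ U'.map I with hS
  have hleft : ∀ x ∈ U', x ∈ S := fun x hx => mem_sup_left hx
  have hright : ∀ x ∈ U', I x ∈ S := fun x hx => mem_sup_right (mem_map_of_mem hx)
  have hind : ∀ A : V →ₗ[ℝ] V, (∀ x ∈ U', A x ∈ S) → (∀ x ∈ U', A (I x) ∈ S) →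
      ∀ x ∈ S, A x ∈ S := by
    intro A h1 h2 x hx
    obtain ⟨y, hy, z, hz, rfl⟩ := mem_sup.mp hx
    obtain ⟨w, hw, rfl⟩ := mem_map.mp hz
    rw [map_add]
    exact S.add_mem (h1 y hy) (h2 w hw)
  have hmap : ∀ A : V →ₗ[ℝ] V, (∀ x, A (A x) = -x) → (∀ x ∈ S, A x ∈ S) → S.map A = S := by
    intro A hA h
    apply le_antisymm
    · rintro _ ⟨x, hx, rfl⟩
      exact h x hx
    · intro x hx
      exact ⟨-(A x), S.neg_mem (h x hx), by rw [map_neg, hA, neg_neg]⟩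
  have SI : ∀ x ∈ S, I x ∈ S :=
    hind I hright fun x hx => by rw [hII]; exact S.neg_mem (hleft x hx)
  have hL : ∀ x ∈ U', b • J x + c • K x ∈ S := by
    intro x hx
    have h1 : (a • I + b • J + c • K) x ∈ U' := by
      rw [← hItU']; exact mem_map_of_mem hx
    have h2 := S.sub_mem (hleft _ h1) (S.smul_mem a (hright x hx))
    convert h2 using 1
    simp only [LinearMap.add_apply, LinearMap.smul_apply]
    abel
  have hJU : ∀ x ∈ U', J x ∈ S := by
    intro x hx
    have h := hL x hx
    have h2 := S.smul_mem (b ^ 2 + c ^ 2)⁻¹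
      (S.sub_mem (S.smul_mem b h) (S.smul_mem c (SI _ h)))
    convert h2 using 1
    rw [eq_inv_smul_iff₀ hbc]
    simp only [map_add, map_smul, hIJ, hIK]
    module
  have SJ : ∀ x ∈ S, J x ∈ S := hind J hJU fun x hx => by
    rw [hJI, ← hIJ]; exact S.neg_mem (SI _ (hJU x hx))
  have SK : ∀ x ∈ S, K x ∈ S := fun x hx => by
    rw [← hIJ]; exact SI _ (SJ x hx)
  have hSU : S ≤ U := sup_le hU'le (by rw [← hUI]; exact map_mono hU'le)
  have hbot := hpure S hSU (hmap I hII SI) (hmap J hJJ SJ) (hmap K hKK SK)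
  exact le_bot_iff.mp (hbot ▸ le_sup_left)
end
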